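/- Let β > 0, γ ∈ ℝ and d ≥ 1. There exists a constant C < ∞ depending only on β, γ and d such that for every measurable function h : ℝ × ℝ^d × ℝ^d → [0,∞], defining (Th)(t,φ,ξ) = ∫_{−∞}^t K(t,s,φ,ξ)·h(s,φ,ξ) ds, one has (∫_ℝ ∫_{ℝ^d} ∫_{ℝ^d} W(t,φ,ξ)^{2γ} · (Th)(t,φ,ξ)² dξ dφ dt)^{1/2} ≤ C · ∫_ℝ (∫_{ℝ^d} ∫_{ℝ^d} W(s,φ,ξ)^{2γ−2β} · h(s,φ,ξ)² dξ dφ)^{1/2} ds. -/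

import Mathlib

open MeasureTheory Real
open scoped ENNReal

/-- The weight `W(t,φ,ξ) = max(‖ξ - tφ‖, ‖φ‖^{1/(1+2β)})`. -/
noncomputable def Wgt (β : ℝ) {d : ℕ} (t : ℝ) (φ ξ : EuclideanSpace ℝ (Fin d)) : ℝ :=
  max ‖ξ - t • φ‖ (‖φ‖ ^ (1 / (1 + 2 * β)))

/-- The Kolmogorov kernel `K(t,s,φ,ξ) = exp(-∫_s^t ‖ξ - τφ‖^{2β} dτ)`. -/
noncomputable def Kker (β : ℝ) {d : ℕ} (t s : ℝ) (φ ξ : EuclideanSpace ℝ (Fin d)) : ℝ :=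
  Real.exp (-(∫ τ in s..t, ‖ξ - τ • φ‖ ^ (2 * β)))

/-- **Minkowski's integral inequality** for the `L²` norm. -/
theorem lintegral_sq_lintegral_rpow_half_le {α δ : Type*} [MeasurableSpace α] [MeasurableSpace δ]
    {μ : Measure α} {ν : Measure δ} [SFinite μ] [SFinite ν] {f : α → δ → ℝ≥0∞}
    (hf : Measurable (Function.uncurry f)) :
    (∫⁻ a, (∫⁻ b, f a b ∂ν) ^ 2 ∂μ) ^ ((1 : ℝ) / 2) ≤
      ∫⁻ b, (∫⁻ a, f a b ^ 2 ∂μ) ^ ((1 : ℝ) / 2) ∂ν := by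
  have hfl (a : α) : Measurable (f a) := hf.comp measurable_prodMk_left
  have hfr (b : δ) : Measurable fun a ↦ f a b := hf.comp measurable_prodMk_right
  have holder (b b' : δ) : ∫⁻ a, f a b * f a b' ∂μ ≤
      (∫⁻ a, f a b ^ 2 ∂μ) ^ ((1 : ℝ) / 2) * (∫⁻ a, f a b' ^ 2 ∂μ) ^ ((1 : ℝ) / 2) := by
    simpa using ENNReal.lintegral_mul_le_Lp_mul_Lq μ Real.HolderConjugate.two_two
      (hfr b).aemeasurable (hfr b').aemeasurable
  have hN : Measurable fun b ↦ (∫⁻ a, f a b ^ 2 ∂μ) ^ ((1 : ℝ) / 2) :=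
    ((hf.pow_const 2).lintegral_prod_left').pow_const _
  have key : ∫⁻ a, (∫⁻ b, f a b ∂ν) ^ 2 ∂μ ≤
      (∫⁻ b, (∫⁻ a, f a b ^ 2 ∂μ) ^ ((1 : ℝ) / 2) ∂ν) ^ 2 := by
    calc ∫⁻ a, (∫⁻ b, f a b ∂ν) ^ 2 ∂μ
        = ∫⁻ a, ∫⁻ b, f a b * ∫⁻ b', f a b' ∂ν ∂ν ∂μ := by
          congr with a
          rw [lintegral_mul_const _ (hfl a), sq]
      _ = ∫⁻ b, ∫⁻ a, f a b * ∫⁻ b', f a b' ∂ν ∂μ ∂ν := by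
          refine lintegral_lintegral_swap (Measurable.aemeasurable ?_)
          exact hf.mul (hf.lintegral_prod_right'.comp measurable_fst)
      _ = ∫⁻ b, ∫⁻ b', ∫⁻ a, f a b * f a b' ∂μ ∂ν ∂ν := by
          congr with b
          rw [← lintegral_lintegral_swap]
          · congr with a
            rw [lintegral_const_mul _ (hfl a)]
          · exact (((hfr b).comp measurable_fst).mul hf).aemeasurable
      _ ≤ ∫⁻ b, ∫⁻ b', (∫⁻ a, f a b ^ 2 ∂μ) ^ ((1 : ℝ) / 2) *
            (∫⁻ a, f a b' ^ 2 ∂μ) ^ ((1 : ℝ) / 2) ∂ν ∂ν :=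
          lintegral_mono fun b ↦ lintegral_mono fun b' ↦ holder b b'
      _ = _ := by
          simp_rw [lintegral_const_mul _ hN]
          rw [lintegral_mul_const _ hN, sq]
  refine (ENNReal.rpow_le_rpow key (by norm_num)).trans_eq ?_
  rw [← ENNReal.rpow_natCast, ← ENNReal.rpow_mul]
  norm_num

theorem exists_one_add_rpow_le_mul_exp {p c : ℝ} (hp : 0 ≤ p) (hc : 0 < c) :
    ∃ B : ℝ, 0 < B ∧ ∀ u : ℝ, 0 ≤ u → (1 + u) ^ p ≤ B * exp (c * u) := by
  set ε : ℝ := min 1 (c / (p + 1))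
  have hε : 0 < ε := lt_min one_pos (by positivity)
  have hpε : p * ε ≤ c := by
    have h1 : (p + 1) * ε ≤ c := by
      rw [mul_comm, ← le_div_iff₀ (by positivity)]
      exact min_le_right _ _
    nlinarith
  refine ⟨ε⁻¹ ^ p, by positivity, fun u hu ↦ ?_⟩
  have h1 : 1 + u ≤ ε⁻¹ * exp (ε * u) := by
    rw [inv_mul_eq_div, le_div_iff₀ hε]
    have := add_one_le_exp (ε * u)
    have : ε ≤ 1 := min_le_left _ _
    nlinarith
  calc (1 + u) ^ p ≤ (ε⁻¹ * exp (ε * u)) ^ p := by gcongr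
    _ = ε⁻¹ ^ p * exp (p * ε * u) := by
      rw [mul_rpow (by positivity) (exp_pos _).le, ← exp_mul]
      ring_nf
    _ ≤ _ := by gcongr

theorem continuous_intervalIntegral_of_continuous_uncurry {X : Type*} [TopologicalSpace X]
    {F : X → ℝ → ℝ} (hF : Continuous (Function.uncurry F)) :
    Continuous fun z : (ℝ × X) × ℝ ↦ ∫ τ in z.2..z.1.1, F z.1.2 τ := by
  have hint (x : X) (a b : ℝ) : IntervalIntegrable (F x) volume a b :=
    (hF.comp (by fun_prop : Continuous fun τ : ℝ ↦ (x, τ))).intervalIntegrable _ _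
  have hF' : Continuous (Function.uncurry fun z : (ℝ × X) × ℝ ↦ F z.1.2) :=
    hF.comp (by fun_prop : Continuous fun r : ((ℝ × X) × ℝ) × ℝ ↦ (r.1.1.2, r.2))
  have h1 := intervalIntegral.continuous_parametric_intervalIntegral_of_continuous
    (μ := volume) (a₀ := 0) hF' (s := fun z ↦ z.1.1) (by fun_prop)
  have h2 := intervalIntegral.continuous_parametric_intervalIntegral_of_continuous
    (μ := volume) (a₀ := 0) hF' (s := fun z ↦ z.2) (by fun_prop)
  convert h1.sub h2 using 2 with z
  exact (intervalIntegral.integral_interval_sub_left (hint _ _ _) (hint _ _ _)).symm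

section Path

variable {E : Type*} [NormedAddCommGroup E] [NormedSpace ℝ E]

theorem norm_path_sub (ξ φ : E) (a b : ℝ) :
    ‖(ξ - a • φ) - (ξ - b • φ)‖ = |b - a| * ‖φ‖ := by
  rw [← Real.norm_eq_abs, ← norm_smul]
  congr 1
  module

theorem continuous_norm_path_rpow {p : ℝ} (hp : 0 ≤ p) (ξ φ : E) :
    Continuous fun τ : ℝ ↦ ‖ξ - τ • φ‖ ^ p :=
  (by fun_prop : Continuous fun τ : ℝ ↦ ‖ξ - τ • φ‖).rpow_const fun _ ↦ Or.inr hp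

theorem sub_mul_rpow_le_integral {p s a b t q : ℝ} (hp : 0 ≤ p) (hsa : s ≤ a) (hab : a ≤ b)
    (hbt : b ≤ t) (hq : 0 ≤ q) {ξ φ : E} (h : ∀ τ ∈ Set.Icc a b, q ≤ ‖ξ - τ • φ‖) :
    (b - a) * q ^ p ≤ ∫ τ in s..t, ‖ξ - τ • φ‖ ^ p := by
  have hc := continuous_norm_path_rpow hp ξ φ
  calc (b - a) * q ^ p = ∫ _ in a..b, q ^ p := by simp
    _ ≤ ∫ τ in a..b, ‖ξ - τ • φ‖ ^ p :=
      intervalIntegral.integral_mono_on hab (by simp) (hc.intervalIntegrable _ _)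
        fun τ hτ ↦ rpow_le_rpow hq (h τ hτ) hp
    _ ≤ _ := intervalIntegral.integral_mono_interval hsa hab hbt
        (Filter.Eventually.of_forall fun τ ↦ by positivity) (hc.intervalIntegrable _ _)

theorem max_rpow_mul_le_integral {p s t : ℝ} (hp : 0 ≤ p) (hst : s ≤ t) (ξ φ : E) :
    (1 / 4) * (1 / 2) ^ p * ((t - s) * (max ‖ξ - s • φ‖ ‖ξ - t • φ‖) ^ p) ≤
      ∫ τ in s..t, ‖ξ - τ • φ‖ ^ p := by
  have hd : (t - s) * ‖φ‖ ≤ ‖ξ - s • φ‖ + ‖ξ - t • φ‖ := by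
    have := norm_sub_le (ξ - s • φ) (ξ - t • φ)
    rwa [norm_path_sub, abs_of_nonneg (sub_nonneg.2 hst)] at this
  have hφ := norm_nonneg φ
  rcases le_total ‖ξ - t • φ‖ ‖ξ - s • φ‖ with h | h
  · rw [max_eq_left h]
    have := sub_mul_rpow_le_integral (s := s) (a := s) (b := s + (t - s) / 4) (t := t)
      (q := 1 / 2 * ‖ξ - s • φ‖) (ξ := ξ) (φ := φ) hp le_rfl (by linarith) (by linarith)
      (by positivity) fun τ hτ ↦ by
        have h1 := norm_sub_norm_le (ξ - s • φ) (ξ - τ • φ)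
        rw [norm_path_sub, abs_of_nonneg (sub_nonneg.2 hτ.1)] at h1
        nlinarith [hτ.2]
    rw [mul_rpow (by norm_num) (norm_nonneg _)] at this
    linarith
  · rw [max_eq_right h]
    have := sub_mul_rpow_le_integral (s := s) (a := t - (t - s) / 4) (b := t) (t := t)
      (q := 1 / 2 * ‖ξ - t • φ‖) (ξ := ξ) (φ := φ) hp (by linarith) (by linarith) le_rfl
      (by positivity) fun τ hτ ↦ by
        have h1 := norm_sub_norm_le (ξ - t • φ) (ξ - τ • φ)
        rw [norm_path_sub, abs_of_nonpos (sub_nonpos.2 hτ.2)] at h1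
        nlinarith [hτ.1]
    rw [mul_rpow (by norm_num) (norm_nonneg _)] at this
    linarith

end Path

section Weight

variable {β : ℝ} {d : ℕ} (φ ξ : EuclideanSpace ℝ (Fin d))

theorem norm_le_Wgt (t : ℝ) : ‖ξ - t • φ‖ ≤ Wgt β t φ ξ := le_max_left _ _

theorem rpow_norm_le_Wgt (t : ℝ) : ‖φ‖ ^ (1 / (1 + 2 * β)) ≤ Wgt β t φ ξ := le_max_right _ _

theorem Wgt_nonneg (t : ℝ) : 0 ≤ Wgt β t φ ξ := (norm_nonneg _).trans (norm_le_Wgt φ ξ t)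

theorem Wgt_pos {φ : EuclideanSpace ℝ (Fin d)} (hφ : φ ≠ 0) (t : ℝ) : 0 < Wgt β t φ ξ :=
  (rpow_pos_of_pos (norm_pos_iff.2 hφ) _).trans_le (rpow_norm_le_Wgt φ ξ t)

theorem norm_eq_rpow_mul_rpow (hβ : 0 < β) :
    ‖φ‖ = ‖φ‖ ^ (1 / (1 + 2 * β)) * (‖φ‖ ^ (1 / (1 + 2 * β))) ^ (2 * β) := by
  rw [← rpow_mul (norm_nonneg _), ← rpow_add' (norm_nonneg _)]
  · rw [show 1 / (1 + 2 * β) + 1 / (1 + 2 * β) * (2 * β) = 1 by field_simp, rpow_one]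
  · rw [show 1 / (1 + 2 * β) + 1 / (1 + 2 * β) * (2 * β) = 1 by field_simp]
    exact one_ne_zero

theorem norm_le_Wgt_mul_rpow (hβ : 0 < β) (s t : ℝ) :
    ‖φ‖ ≤ Wgt β t φ ξ * Wgt β s φ ξ ^ (2 * β) := by
  rw [norm_eq_rpow_mul_rpow φ hβ]
  have := Wgt_nonneg (β := β) φ ξ t
  gcongr
  · exact rpow_norm_le_Wgt φ ξ t
  · exact rpow_norm_le_Wgt φ ξ s

theorem Wgt_le_add (s t : ℝ) : Wgt β t φ ξ ≤ Wgt β s φ ξ + |t - s| * ‖φ‖ := by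
  refine max_le ?_ ((rpow_norm_le_Wgt φ ξ s).trans (le_add_of_nonneg_right (by positivity)))
  have h1 := norm_sub_norm_le (ξ - t • φ) (ξ - s • φ)
  rw [norm_path_sub, abs_sub_comm] at h1
  linarith [norm_le_Wgt (β := β) φ ξ s]

theorem Wgt_le_mul (hβ : 0 < β) {s t : ℝ} (hst : s ≤ t) :
    Wgt β t φ ξ ≤ Wgt β s φ ξ * (1 + (t - s) * Wgt β s φ ξ ^ (2 * β)) := by
  have h1 := Wgt_le_add (β := β) φ ξ s t
  have h2 := norm_le_Wgt_mul_rpow φ ξ hβ s s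
  rw [abs_of_nonneg (sub_nonneg.2 hst)] at h1
  nlinarith [sub_nonneg.2 hst]

theorem Wgt_le_mul' (hβ : 0 < β) {s t : ℝ} (hst : s ≤ t) :
    Wgt β s φ ξ ≤ Wgt β t φ ξ * (1 + (t - s) * Wgt β s φ ξ ^ (2 * β)) := by
  have h1 := Wgt_le_add (β := β) φ ξ t s
  have h2 := norm_le_Wgt_mul_rpow φ ξ hβ s t
  rw [abs_sub_comm, abs_of_nonneg (sub_nonneg.2 hst)] at h1
  nlinarith [sub_nonneg.2 hst]

theorem Wgt_rpow_le (hβ : 0 < β) {φ : EuclideanSpace ℝ (Fin d)} (hφ : φ ≠ 0) (p : ℝ)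
    {s t : ℝ} (hst : s ≤ t) :
    Wgt β t φ ξ ^ p ≤
      Wgt β s φ ξ ^ p * (1 + (t - s) * Wgt β s φ ξ ^ (2 * β)) ^ |p| := by
  have hs := Wgt_pos (β := β) ξ hφ s
  have ht := Wgt_pos (β := β) ξ hφ t
  have hu : 0 < 1 + (t - s) * Wgt β s φ ξ ^ (2 * β) := by
    have := sub_nonneg.2 hst
    positivity
  rcases le_total 0 p with hp | hp
  · rw [abs_of_nonneg hp, ← mul_rpow hs.le hu.le]
    exact rpow_le_rpow ht.le (Wgt_le_mul φ ξ hβ hst) hp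
  · rw [abs_of_nonpos hp, rpow_neg hu.le, ← div_eq_mul_inv, ← div_rpow hs.le hu.le]
    refine rpow_le_rpow_of_nonpos (by positivity) ?_ hp
    rw [div_le_iff₀ hu]
    exact Wgt_le_mul' φ ξ hβ hst

theorem sub_mul_Wgt_rpow_le_integral (hβ : 0 < β) {s t : ℝ} (hst : s ≤ t) :
    (1 / 4) * (1 / 2) ^ (2 * β) * ((t - s) * Wgt β s φ ξ ^ (2 * β) - 2) ≤
      ∫ τ in s..t, ‖ξ - τ • φ‖ ^ (2 * β) := by
  have hts := sub_nonneg.2 hst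
  have hmax := max_rpow_mul_le_integral (p := 2 * β) (by positivity) hst ξ φ
  have hW := Wgt_nonneg (β := β) φ ξ s
  rcases le_or_gt (Wgt β s φ ξ) (max ‖ξ - s • φ‖ ‖ξ - t • φ‖) with h | h
  · refine le_trans ?_ hmax
    have := mul_le_mul_of_nonneg_left (rpow_le_rpow hW h (by positivity : 0 ≤ 2 * β)) hts
    gcongr
    linarith
  · refine le_trans (mul_nonpos_of_nonneg_of_nonpos (by positivity) ?_)
      (intervalIntegral.integral_nonneg hst fun τ _ ↦ by positivity)
    obtain ⟨h1, h2⟩ := max_lt_iff.1 h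
    have hm : Wgt β s φ ξ = ‖φ‖ ^ (1 / (1 + 2 * β)) := by
      rcases le_total ‖ξ - s • φ‖ (‖φ‖ ^ (1 / (1 + 2 * β))) with h' | h'
      · exact max_eq_right h'
      · exact absurd (max_eq_left h') h1.ne'
    have hφ : ‖φ‖ = Wgt β s φ ξ * Wgt β s φ ξ ^ (2 * β) := by
      rw [hm]
      exact norm_eq_rpow_mul_rpow φ hβ
    have hd := norm_sub_le (ξ - s • φ) (ξ - t • φ)
    rw [norm_path_sub, abs_of_nonneg hts, hφ] at hd
    have hW' : 0 < Wgt β s φ ξ := (norm_nonneg _).trans_lt h1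
    have : Wgt β s φ ξ * ((t - s) * Wgt β s φ ξ ^ (2 * β)) ≤ Wgt β s φ ξ * 2 := by
      linarith
    linarith [le_of_mul_le_mul_left this hW']

theorem exists_lintegral_Wgt_mul_Kker_sq_le (hβ : 0 < β) (γ : ℝ) :
    ∃ C : ℝ≥0∞, C ≠ ⊤ ∧ ∀ (d : ℕ) (s : ℝ) (φ ξ : EuclideanSpace ℝ (Fin d)), φ ≠ 0 →
      ∫⁻ t in Set.Ici s, ENNReal.ofReal (Wgt β t φ ξ ^ (2 * γ)) *
          ENNReal.ofReal (Kker β t s φ ξ) ^ 2 ≤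
        C * ENNReal.ofReal (Wgt β s φ ξ ^ (2 * γ - 2 * β)) := by
  set c : ℝ := (1 / 4) * (1 / 2) ^ (2 * β) with hc
  have hc0 : 0 < c := by positivity
  obtain ⟨B, hB0, hB⟩ := exists_one_add_rpow_le_mul_exp (abs_nonneg (2 * γ)) hc0
  refine ⟨ENNReal.ofReal (B * exp (4 * c) / c), ENNReal.ofReal_ne_top, fun d s φ ξ hφ ↦ ?_⟩
  have hW := Wgt_pos (β := β) ξ hφ s
  set k : ℝ := Wgt β s φ ξ ^ (2 * β) with hk
  have hk0 : 0 < k := by positivity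
  set A : ℝ := B * exp (4 * c) * Wgt β s φ ξ ^ (2 * γ) * exp (c * k * s) with hA
  have hA0 : 0 < A := by positivity
  have hneg : -(c * k) < 0 := by
    have : 0 < c * k := by positivity
    linarith
  have hpt (t : ℝ) (hst : s ≤ t) : ENNReal.ofReal (Wgt β t φ ξ ^ (2 * γ)) *
      ENNReal.ofReal (Kker β t s φ ξ) ^ 2 ≤ ENNReal.ofReal (A * exp (-(c * k) * t)) := by
    have hWt := Wgt_pos (β := β) ξ hφ t
    rw [← ENNReal.ofReal_pow (by unfold Kker; positivity), ← ENNReal.ofReal_mul (by positivity)]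
    refine ENNReal.ofReal_le_ofReal ?_
    have hu : 0 ≤ (t - s) * k := mul_nonneg (sub_nonneg.2 hst) hk0.le
    have hK : Kker β t s φ ξ ^ 2 ≤ exp (4 * c - 2 * (c * ((t - s) * k))) := by
      rw [Kker, ← exp_nat_mul]
      refine exp_le_exp.2 ?_
      have := sub_mul_Wgt_rpow_le_integral φ ξ hβ hst
      rw [← hc, ← hk] at this
      push_cast
      linarith
    calc Wgt β t φ ξ ^ (2 * γ) * Kker β t s φ ξ ^ 2
        ≤ Wgt β s φ ξ ^ (2 * γ) * (B * exp (c * ((t - s) * k))) *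
            exp (4 * c - 2 * (c * ((t - s) * k))) := by
          gcongr
          refine (Wgt_rpow_le ξ hβ hφ (2 * γ) hst).trans ?_
          gcongr
          exact hB _ hu
      _ = B * Wgt β s φ ξ ^ (2 * γ) *
            (exp (c * ((t - s) * k)) * exp (4 * c - 2 * (c * ((t - s) * k)))) := by ring
      _ = B * Wgt β s φ ξ ^ (2 * γ) *
            (exp (4 * c) * (exp (c * k * s) * exp (-(c * k) * t))) := by
          simp only [← exp_add]
          ring_nf
      _ = A * exp (-(c * k) * t) := by rw [hA]; ring
  calc ∫⁻ t in Set.Ici s, ENNReal.ofReal (Wgt β t φ ξ ^ (2 * γ)) *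
          ENNReal.ofReal (Kker β t s φ ξ) ^ 2
      ≤ ∫⁻ t in Set.Ici s, ENNReal.ofReal (A * exp (-(c * k) * t)) :=
        setLIntegral_mono' measurableSet_Ici hpt
    _ = ENNReal.ofReal (∫ t in Set.Ioi s, A * exp (-(c * k) * t)) := by
        rw [setLIntegral_congr Ioi_ae_eq_Ici.symm, ofReal_integral_eq_lintegral_ofReal]
        · exact (integrableOn_exp_mul_Ioi hneg s).const_mul A
        · exact Filter.Eventually.of_forall fun t ↦ by positivity
    _ = _ := by
        rw [integral_const_mul, integral_exp_mul_Ioi hneg, ← ENNReal.ofReal_mul (by positivity),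
          rpow_sub hW, hA, ← hk]
        congr 1
        have : exp (c * k * s) * exp (-(c * k * s)) = 1 := by
          rw [← exp_add]; simp
        field_simp
        linear_combination this

theorem continuous_Wgt (hβ : 0 < β) :
    Continuous fun z : ℝ × EuclideanSpace ℝ (Fin d) × EuclideanSpace ℝ (Fin d) ↦
      Wgt β z.1 z.2.1 z.2.2 := by
  unfold Wgt
  refine Continuous.max (by fun_prop) ?_
  exact (by fun_prop : Continuous fun z :
    ℝ × EuclideanSpace ℝ (Fin d) × EuclideanSpace ℝ (Fin d) ↦ ‖z.2.1‖).rpow_const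
      fun _ ↦ Or.inr (by positivity)

theorem continuous_Kker (hβ : 0 < β) :
    Continuous fun z : (ℝ × EuclideanSpace ℝ (Fin d) × EuclideanSpace ℝ (Fin d)) × ℝ ↦
      Kker β z.1.1 z.2 z.1.2.1 z.1.2.2 := by
  have hF : Continuous (Function.uncurry fun
      (p : EuclideanSpace ℝ (Fin d) × EuclideanSpace ℝ (Fin d)) (τ : ℝ) ↦
        ‖p.2 - τ • p.1‖ ^ (2 * β)) :=
    (by fun_prop : Continuous fun q :
      (EuclideanSpace ℝ (Fin d) × EuclideanSpace ℝ (Fin d)) × ℝ ↦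
        ‖q.1.2 - q.2 • q.1.1‖).rpow_const fun _ ↦ Or.inr (by positivity)
  exact continuous_exp.comp (continuous_intervalIntegral_of_continuous_uncurry hF).neg

end Weight

/-- Proof of Proposition 2.10, third mapping property:
`T : L¹_t L²_{φ,ξ}(W^{2γ-2β}) → L²_{φ,ξ} L²_t(W^{2γ})` is bounded, with a constant
depending only on `β`, `γ` and `d`. -/
theorem duhamel_L1L2_to_L2L2 (β γ : ℝ) (hβ : 0 < β) (d : ℕ) (hd : 1 ≤ d) :
    ∃ C : ℝ≥0∞, C ≠ ⊤ ∧
      ∀ h : ℝ × EuclideanSpace ℝ (Fin d) × EuclideanSpace ℝ (Fin d) → ℝ≥0∞,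
        Measurable h →
          (∫⁻ t : ℝ, ∫⁻ φ : EuclideanSpace ℝ (Fin d), ∫⁻ ξ : EuclideanSpace ℝ (Fin d),
              ENNReal.ofReal (Wgt β t φ ξ ^ (2 * γ)) *
                (∫⁻ s in Set.Iic t,
                  ENNReal.ofReal (Kker β t s φ ξ) * h (s, φ, ξ)) ^ 2) ^ ((1 : ℝ) / 2)
            ≤ C * ∫⁻ s : ℝ,
                (∫⁻ φ : EuclideanSpace ℝ (Fin d), ∫⁻ ξ : EuclideanSpace ℝ (Fin d),
                  ENNReal.ofReal (Wgt β s φ ξ ^ (2 * γ - 2 * β)) *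
                    h (s, φ, ξ) ^ 2) ^ ((1 : ℝ) / 2) := by
  obtain ⟨C, hC, hCle⟩ := exists_lintegral_Wgt_mul_Kker_sq_le hβ γ
  have : Nontrivial (EuclideanSpace ℝ (Fin d)) := by
    have : Nonempty (Fin d) := ⟨⟨0, hd⟩⟩
    infer_instance
  set E := EuclideanSpace ℝ (Fin d)
  refine ⟨C ^ ((1 : ℝ) / 2), ENNReal.rpow_ne_top_of_nonneg (by norm_num) hC, fun h hh ↦ ?_⟩
  have hW : Measurable fun z : ℝ × E × E ↦ Wgt β z.1 z.2.1 z.2.2 :=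
    (continuous_Wgt hβ).measurable
  have hK : Measurable fun z : (ℝ × E × E) × ℝ ↦ Kker β z.1.1 z.2 z.1.2.1 z.1.2.2 :=
    (continuous_Kker hβ).measurable
  set g : ℝ × E × E → ℝ → ℝ≥0∞ := fun z s ↦
    {q : (ℝ × E × E) × ℝ | q.2 ≤ q.1.1}.indicator (fun q ↦
      ENNReal.ofReal (Wgt β q.1.1 q.1.2.1 q.1.2.2 ^ γ) *
        (ENNReal.ofReal (Kker β q.1.1 q.2 q.1.2.1 q.1.2.2) * h (q.2, q.1.2))) (z, s) with hg
  have hgm : Measurable (Function.uncurry g) := by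
    refine Measurable.indicator ?_ (measurableSet_le (by fun_prop) (by fun_prop))
    exact ((hW.comp measurable_fst).pow_const γ).ennreal_ofReal.mul
      (hK.ennreal_ofReal.mul (hh.comp (by fun_prop)))
  have hsq (t : ℝ) (φ ξ : E) :
      ENNReal.ofReal (Wgt β t φ ξ ^ γ) ^ 2 = ENNReal.ofReal (Wgt β t φ ξ ^ (2 * γ)) := by
    have := Wgt_nonneg (β := β) φ ξ t
    rw [← ENNReal.ofReal_pow (by positivity), mul_comm, rpow_mul this, rpow_two]
  have hinner (t : ℝ) (φ ξ : E) : (∫⁻ s, g (t, φ, ξ) s) ^ 2 =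
      ENNReal.ofReal (Wgt β t φ ξ ^ (2 * γ)) *
        (∫⁻ s in Set.Iic t, ENNReal.ofReal (Kker β t s φ ξ) * h (s, φ, ξ)) ^ 2 := by
    rw [← hsq, ← mul_pow, ← lintegral_const_mul', ← lintegral_indicator measurableSet_Iic]
    · rfl
    · exact ENNReal.ofReal_ne_top
  have houter (s : ℝ) : ∫⁻ z, g z s ^ 2 ≤ C * ∫⁻ φ : E, ∫⁻ ξ : E,
      ENNReal.ofReal (Wgt β s φ ξ ^ (2 * γ - 2 * β)) * h (s, φ, ξ) ^ 2 := by
    have hgs : Measurable fun z ↦ g z s ^ 2 :=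
      (hgm.comp measurable_prodMk_right).pow_const 2
    have hWs : Measurable fun p : E × E ↦
        ENNReal.ofReal (Wgt β s p.1 p.2 ^ (2 * γ - 2 * β)) * h (s, p) ^ 2 :=
      ((hW.comp measurable_prodMk_left).pow_const _).ennreal_ofReal.mul
        ((hh.comp measurable_prodMk_left).pow_const 2)
    have hpt (φ ξ : E) (hφ : φ ≠ 0) : ∫⁻ t, g (t, φ, ξ) s ^ 2 ≤
        C * (ENNReal.ofReal (Wgt β s φ ξ ^ (2 * γ - 2 * β)) * h (s, φ, ξ) ^ 2) := by
      have hm : Measurable fun t : ℝ ↦ ENNReal.ofReal (Wgt β t φ ξ ^ (2 * γ)) *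
          ENNReal.ofReal (Kker β t s φ ξ) ^ 2 :=
        ((hW.comp (measurable_prodMk_right (y := (φ, ξ)))).pow_const _).ennreal_ofReal.mul
          ((hK.comp (by fun_prop : Measurable fun t : ℝ ↦
            ((t, φ, ξ), s))).ennreal_ofReal.pow_const 2)
      calc ∫⁻ t, g (t, φ, ξ) s ^ 2
          = ∫⁻ t in Set.Ici s, ENNReal.ofReal (Wgt β t φ ξ ^ (2 * γ)) *
              ENNReal.ofReal (Kker β t s φ ξ) ^ 2 * h (s, φ, ξ) ^ 2 := by
            rw [← lintegral_indicator measurableSet_Ici]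
            congr with t
            by_cases hst : s ≤ t
            · simp only [hg, Set.indicator, Set.mem_ofPred_eq, Set.mem_Ici, hst, if_true, mul_pow,
                hsq, mul_assoc]
            · simp [hg, Set.indicator, hst]
        _ ≤ _ := by
            rw [lintegral_mul_const _ hm, ← mul_assoc]
            gcongr
            exact hCle d s φ ξ hφ
    calc ∫⁻ z, g z s ^ 2 = ∫⁻ p : E × E, ∫⁻ t : ℝ, g (t, p) s ^ 2 :=
          lintegral_prod_symm' _ hgs
      _ = ∫⁻ φ : E, ∫⁻ ξ : E, ∫⁻ t : ℝ, g (t, φ, ξ) s ^ 2 :=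
          lintegral_prod _ hgs.lintegral_prod_left'.aemeasurable
      _ ≤ ∫⁻ φ : E, ∫⁻ ξ : E,
            C * (ENNReal.ofReal (Wgt β s φ ξ ^ (2 * γ - 2 * β)) * h (s, φ, ξ) ^ 2) := by
          refine lintegral_mono_ae ?_
          filter_upwards [Measure.ae_ne volume (0 : E)] with φ hφ
          exact lintegral_mono fun ξ ↦ hpt φ ξ hφ
      _ = _ := by
          simp_rw [lintegral_const_mul' C _ hC]
  calc _ = (∫⁻ z, (∫⁻ s, g z s) ^ 2) ^ ((1 : ℝ) / 2) := by
        have hGm : Measurable fun z ↦ (∫⁻ s, g z s) ^ 2 := hgm.lintegral_prod_right'.pow_const 2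
        congr 1
        rw [Measure.volume_eq_prod, lintegral_prod _ hGm.aemeasurable]
        congr with t
        refine Eq.trans ?_ (lintegral_prod (fun p ↦ (∫⁻ s, g (t, p) s) ^ 2)
          (hGm.comp measurable_prodMk_left).aemeasurable).symm
        simp_rw [hinner]
        rfl
    _ ≤ ∫⁻ s, (∫⁻ z, g z s ^ 2) ^ ((1 : ℝ) / 2) := lintegral_sq_lintegral_rpow_half_le hgm
    _ ≤ ∫⁻ s, C ^ ((1 : ℝ) / 2) * (∫⁻ φ : E, ∫⁻ ξ : E,
          ENNReal.ofReal (Wgt β s φ ξ ^ (2 * γ - 2 * β)) * h (s, φ, ξ) ^ 2) ^ ((1 : ℝ) / 2) := by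
        refine lintegral_mono fun s ↦ ?_
        rw [← ENNReal.mul_rpow_of_nonneg _ _ (by norm_num)]
        exact ENNReal.rpow_le_rpow (houter s) (by norm_num)
    _ = _ := lintegral_const_mul' _ _ (ENNReal.rpow_ne_top_of_nonneg (by norm_num) hC)
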